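/- Let P : Fin 3 → Fin 3 → ℕ be the matrix with rows (2,3,5), (7,11,13), (17,19,23). Then for every walk V : Fin 12 → Fin 3 of length 11 there exists a walk U : Fin 6 → Fin 3 of length 5 with U 0 = V 0 and U 5 = V 11 such that the product ∏_{r=0}^{4} P (U r) (U (r+1)) divides the product ∏_{s=0}^{10} P (V s) (V (s+1)) in ℕ. -/

import Mathlib

/-- The matrix of nine distinct primes used in the proof of Lemma 3.2. -/
def primeMatrix : Fin 3 → Fin 3 → ℕ :=
  ![![2, 3, 5], ![7, 11, 13], ![17, 19, 23]]

/-- The product of `primeMatrix` along a walk of length `l`. -/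
def walkProd {l : ℕ} (V : Fin (l + 1) → Fin 3) : ℕ :=
  ∏ s : Fin l, primeMatrix (V s.castSucc) (V s.succ)

/-- Some walk of length `k` from `a` to `b` has a product dividing `m`. -/
def HasWalkDvd (k : ℕ) (a b : Fin 3) (m : ℕ) : Prop :=
  ∃ U : Fin (k + 1) → Fin 3, U 0 = a ∧ U (Fin.last k) = b ∧ walkProd U ∣ m

theorem walkProd_succ {l : ℕ} (V : Fin (l + 2) → Fin 3) :
    walkProd V = primeMatrix (V 0) (V 1) * walkProd (Fin.tail V) := by
  simp [walkProd, Fin.prod_univ_succ, Fin.tail]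

theorem HasWalkDvd.cons {k : ℕ} {a b c : Fin 3} {m : ℕ} (h : HasWalkDvd k c b m) :
    HasWalkDvd (k + 1) a b (primeMatrix a c * m) := by
  obtain ⟨U, rfl, rfl, hU⟩ := h
  refine ⟨Fin.cons a U, rfl, by simp [← Fin.succ_last], ?_⟩
  rw [walkProd_succ, Fin.tail_cons]
  exact mul_dvd_mul_left _ hU

theorem HasWalkDvd.snoc {k : ℕ} {a b c : Fin 3} {m : ℕ} (h : HasWalkDvd k a b m) :
    HasWalkDvd (k + 1) a c (m * primeMatrix b c) := by
  obtain ⟨U, rfl, rfl, hU⟩ := h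
  refine ⟨Fin.snoc U c, Fin.snoc_castSucc (α := fun _ => Fin 3) c U 0, by simp, ?_⟩
  rw [walkProd, Fin.prod_univ_castSucc]
  simp only [← Fin.castSucc_succ, Fin.succ_last, Fin.snoc_castSucc, Fin.snoc_last]
  exact mul_dvd_mul_right hU _

theorem HasWalkDvd.append {k f : ℕ} {a : Fin 3} {m : ℕ} (V : Fin (f + 1) → Fin 3)
    (h : HasWalkDvd k a (V 0) m) :
    HasWalkDvd (k + f) a (V (Fin.last f)) (m * walkProd V) := by
  induction f generalizing k m with
  | zero => simpa [walkProd] using h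
  | succ f ih =>
    have := ih (Fin.tail V) (h.snoc (c := V 1))
    rwa [mul_assoc, ← walkProd_succ, add_right_comm] at this

/-- Depth-first search deciding `HasWalkDvd`. -/
def findWalk : ℕ → Fin 3 → Fin 3 → ℕ → Bool
  | 0, a, b, _ => a == b
  | k + 1, a, b, m => [0, 1, 2].any fun c =>
      Nat.beq (m % primeMatrix a c) 0 && findWalk k c b (m / primeMatrix a c)

theorem hasWalkDvd_of_findWalk {k : ℕ} {a b : Fin 3} {m : ℕ} (h : findWalk k a b m = true) :
    HasWalkDvd k a b m := by
  induction k generalizing a m with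
  | zero => exact ⟨fun _ => a, rfl, by simpa [findWalk] using h, by simp [walkProd]⟩
  | succ k ih =>
    obtain ⟨c, -, hc⟩ := List.any_eq_true.mp h
    rw [Bool.and_eq_true, Nat.beq_eq, ← Nat.dvd_iff_mod_eq_zero] at hc
    simpa only [Nat.mul_div_cancel' hc.1] using (ih hc.2).cons (a := a)

/-- Checks that every walk from `a` that extends a walk to `b` of product `m` by `f` steps admits
a walk of length `L` with the same endpoints and with a product dividing its own. The search stops
as soon as the part walked so far already dominates a walk of length `L - f`. Matching on `m` makes the
kernel evaluate the product at every step. -/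
def checkExtensions (L : ℕ) (a : Fin 3) : ℕ → Fin 3 → ℕ → Bool
  | _, _, 0 => false
  | 0, b, m + 1 => findWalk L a b (m + 1)
  | f + 1, b, m + 1 => (Nat.ble (f + 1) L && findWalk (L - (f + 1)) a b (m + 1)) ||
      [0, 1, 2].all fun c => checkExtensions L a f c ((m + 1) * primeMatrix b c)

theorem hasWalkDvd_of_checkExtensions {L f : ℕ} {a : Fin 3} {m : ℕ} (V : Fin (f + 1) → Fin 3)
    (h : checkExtensions L a f (V 0) m = true) :
    HasWalkDvd L a (V (Fin.last f)) (m * walkProd V) := by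
  induction f generalizing m with
  | zero =>
    obtain _ | m := m
    · simp [checkExtensions] at h
    exact (hasWalkDvd_of_findWalk h).append V
  | succ f ih =>
    obtain _ | m := m
    · simp [checkExtensions] at h
    rw [checkExtensions, Bool.or_eq_true, Bool.and_eq_true, Nat.ble_eq] at h
    rcases h with ⟨hf, h⟩ | h
    · simpa only [Nat.sub_add_cancel hf] using (hasWalkDvd_of_findWalk h).append V
    · have hV := ih (Fin.tail V)
        (List.all_eq_true.mp h (V 1) (by generalize V 1 = c; revert c; decide))
      rwa [mul_assoc, ← walkProd_succ] at hV

theorem checkExtensions_five_eleven (a : Fin 3) : checkExtensions 5 a 11 a 1 = true := by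
  revert a
  decide +kernel

/-- For every walk of length 11 on `Fin 3` there is a walk of length 5
with the same endpoints whose `primeMatrix`-product divides that of the long walk. -/
theorem exists_length_five_walk_dvd (V : Fin 12 → Fin 3) :
    ∃ U : Fin 6 → Fin 3, U 0 = V 0 ∧ U 5 = V 11 ∧
      (∏ r : Fin 5, primeMatrix (U r.castSucc) (U r.succ)) ∣
        ∏ s : Fin 11, primeMatrix (V s.castSucc) (V s.succ) := by
  have h := hasWalkDvd_of_checkExtensions V (checkExtensions_five_eleven (V 0))
  rwa [one_mul] at h
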